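/- arXiv:1911.09442 — 6 statements merged into one kernel-verified Lean document; each statement's English description precedes it below -/
import Mathlib

section
/- The spectrum of G, counted with multiplicity, is the multiset consisting of the value s₀ with multiplicity d·p together with the values (d+1)·μ − d·s₀ as μ ranges over the eigenvalues of Σ (with multiplicity). Consequently the minimal eigenvalue of G is min(s₀, (d+1)·λ_min(Σ) − d·s₀), where λ_min(Σ) denotes the minimal eigenvalue of Σ. -/
open Matrix

/-- The `(d+1)p × (d+1)p` matrix `G`, indexed in block form by `Fin (d+1) × Fin p`
(the pair `(i₁, i₀)` corresponds to the linear index `i₀ + i₁·p`): the diagonal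
`p × p` blocks are `Σ` and the off-diagonal blocks are `Σ₀ = Σ - s₀·I`. -/
def knockoffGram (p d : ℕ) (Sig : Matrix (Fin p) (Fin p) ℝ) (s₀ : ℝ) :
    Matrix (Fin (d + 1) × Fin p) (Fin (d + 1) × Fin p) ℝ :=
  fun i j =>
    if i.1 = j.1 then Sig i.2 j.2
    else (Sig - s₀ • (1 : Matrix (Fin p) (Fin p) ℝ)) i.2 j.2

open Polynomial in
/-- If `A - s` factors as `B * C`, the eigenvalues of `A`, shifted by `s`, agree up to zeros with
the roots of the characteristic polynomial of `C * B`. -/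
theorem Matrix.IsHermitian.map_eigenvalues_sub_add_replicate {m n : Type*} [Fintype m]
    [DecidableEq m] [Fintype n] [DecidableEq n] {A : Matrix m m ℝ} (hA : A.IsHermitian) (s : ℝ)
    (B : Matrix m n ℝ) (C : Matrix n m ℝ) (h : A - scalar m s = B * C) :
    Finset.univ.val.map (fun i => hA.eigenvalues i - s)
        + Multiset.replicate (Fintype.card n) 0
      = Multiset.replicate (Fintype.card m) 0 + (C * B).charpoly.roots := by
  have key := charpoly_mul_comm' B C
  rw [← h, charpoly_sub_scalar, hA.charpoly_eq, Polynomial.prod_comp] at key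
  have hfac : ∀ i, (X - Polynomial.C (hA.eigenvalues i : ℝ)).comp (X + Polynomial.C s)
      = X - Polynomial.C (hA.eigenvalues i - s) := fun i => by
    simp only [sub_comp, X_comp, C_comp, map_sub]; ring
  have hroots := congrArg roots key
  simp only [RCLike.ofReal_real_eq_id, id_eq] at hroots
  simp only [hfac] at hroots
  rw [roots_mul, roots_mul, roots_X_pow, roots_X_pow, roots_prod] at hroots
  · simpa [Multiset.nsmul_singleton, add_comm, -map_sub] using hroots
  · exact Finset.prod_ne_zero_iff.2 fun i _ => X_sub_C_ne_zero _
  · exact mul_ne_zero (pow_ne_zero _ X_ne_zero) (charpoly_monic _).ne_zero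
  · exact mul_ne_zero (pow_ne_zero _ X_ne_zero)
      (Finset.prod_ne_zero_iff.2 fun i _ => X_sub_C_ne_zero _)

open Polynomial in
/-- The roots of the characteristic polynomial of an affine function of a Hermitian matrix. -/
theorem Matrix.IsHermitian.roots_charpoly_smul_sub_smul_one {n : Type*} [Fintype n]
    [DecidableEq n] {A : Matrix n n ℝ} (hA : A.IsHermitian) (c s : ℝ) :
    (c • (A - s • (1 : Matrix n n ℝ))).charpoly.roots
      = Finset.univ.val.map (fun i => c * (hA.eigenvalues i - s)) := by
  have hA' : IsSelfAdjoint A := hA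
  have hcfc : cfc (fun x : ℝ => c * (x - s)) A = c • (A - s • (1 : Matrix n n ℝ)) := by
    rw [cfc_const_mul .., cfc_sub .., cfc_id' .., cfc_const .., Algebra.algebraMap_eq_smul_one]
  rw [← hcfc, hA.charpoly_cfc_eq, roots_prod _ _
    (Finset.prod_ne_zero_iff.2 fun i _ => X_sub_C_ne_zero _)]
  simp [-map_sub, -map_mul]

/-- `G - s₀` factors through `ℝ^p` as a column of identities times a row of copies of `Σ₀`. -/
theorem knockoffGram_sub_scalar (p d : ℕ) (Sig : Matrix (Fin p) (Fin p) ℝ) (s₀ : ℝ) :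
    knockoffGram p d Sig s₀ - scalar (Fin (d + 1) × Fin p) s₀
      = (of fun i k => (1 : Matrix (Fin p) (Fin p) ℝ) i.2 k)
        * (of fun k j => (Sig - s₀ • (1 : Matrix (Fin p) (Fin p) ℝ)) k j.2) := by
  ext ⟨a, i⟩ ⟨b, j⟩
  by_cases hab : a = b <;> by_cases hij : i = j <;>
    simp [knockoffGram, mul_apply, one_apply, hab, hij]

/-- The eigenvalues of `G` with multiplicity. -/
theorem map_eigenvalues_knockoffGram (p d : ℕ) {Sig : Matrix (Fin p) (Fin p) ℝ}
    (hSig : Sig.IsHermitian) (s₀ : ℝ) (hG : (knockoffGram p d Sig s₀).IsHermitian) :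
    Finset.univ.val.map hG.eigenvalues
      = Multiset.replicate (d * p) s₀
        + Finset.univ.val.map
            (fun i => ((d : ℝ) + 1) * hSig.eigenvalues i - (d : ℝ) * s₀) := by
  have key := hG.map_eigenvalues_sub_add_replicate s₀ _ _ (knockoffGram_sub_scalar p d Sig s₀)
  have hmul : (of fun k (j : Fin (d + 1) × Fin p) =>
        (Sig - s₀ • (1 : Matrix (Fin p) (Fin p) ℝ)) k j.2)
      * (of fun (i : Fin (d + 1) × Fin p) k => (1 : Matrix (Fin p) (Fin p) ℝ) i.2 k)
      = ((d : ℝ) + 1) • (Sig - s₀ • (1 : Matrix (Fin p) (Fin p) ℝ)) := by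
    ext i j
    by_cases hij : i = j <;>
      simp [Matrix.mul_apply, Fintype.sum_prod_type, one_apply, hij, mul_sub]
  rw [hmul, hSig.roots_charpoly_smul_sub_smul_one] at key
  have hcard : Fintype.card (Fin (d + 1) × Fin p) = d * p + Fintype.card (Fin p) := by
    simp; ring
  rw [hcard, Multiset.replicate_add, add_right_comm, add_left_inj] at key
  have hshift := congrArg (Multiset.map (· + s₀)) key
  rw [Multiset.map_add, Multiset.map_map, Multiset.map_map, Multiset.map_replicate] at hshift
  simp only [Function.comp_def, sub_add_cancel, zero_add] at hshift
  rw [hshift]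
  congr 2
  ext i
  ring

/-- The spectrum of `G`, with multiplicity, consists of `s₀` with multiplicity `d·p`
together with `(d+1)·μ − d·s₀` for `μ` ranging over the eigenvalues of `Σ` (with
multiplicity); consequently the minimal eigenvalue of `G` is
`min (s₀, (d+1)·λ_min(Σ) − d·s₀)`. -/
theorem spectrum_of_knockoffGram (p d : ℕ) (hp : 1 ≤ p) (hd : 1 ≤ d)
    (Sig : Matrix (Fin p) (Fin p) ℝ) (hSig : Sig.PosSemidef) (s₀ : ℝ)
    (hG : (knockoffGram p d Sig s₀).IsHermitian) :
    (Finset.univ.val.map hG.eigenvalues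
        = Multiset.replicate (d * p) s₀
          + Finset.univ.val.map
              (fun i => ((d : ℝ) + 1) * hSig.isHermitian.eigenvalues i - (d : ℝ) * s₀))
      ∧ Finset.univ.inf' ⟨((0 : Fin (d + 1)), (⟨0, hp⟩ : Fin p)), Finset.mem_univ _⟩
            hG.eigenvalues
          = min s₀
              (((d : ℝ) + 1)
                  * Finset.univ.inf' ⟨(⟨0, hp⟩ : Fin p), Finset.mem_univ _⟩
                      hSig.isHermitian.eigenvalues
                - (d : ℝ) * s₀) := by
  have hspec := map_eigenvalues_knockoffGram p d hSig.isHermitian s₀ hG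
  refine ⟨hspec, ?_⟩
  have hmem : ∀ x, (∃ i, hG.eigenvalues i = x) ↔
      x = s₀ ∨ ∃ i, ((d : ℝ) + 1) * hSig.isHermitian.eigenvalues i - (d : ℝ) * s₀ = x := fun x => by
    have hx := congrArg (x ∈ ·) hspec
    simpa [Multiset.mem_replicate, Nat.ne_of_gt hd, Nat.ne_of_gt hp] using hx
  apply le_antisymm
  · refine le_min ?_ ?_
    · obtain ⟨i, hi⟩ := (hmem s₀).2 (Or.inl rfl)
      exact (Finset.inf'_le _ (Finset.mem_univ i)).trans_eq hi
    · obtain ⟨j, -, hj⟩ := Finset.exists_mem_eq_inf' ⟨(⟨0, hp⟩ : Fin p), Finset.mem_univ _⟩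
        hSig.isHermitian.eigenvalues
      rw [hj]
      obtain ⟨i, hi⟩ := (hmem _).2 (Or.inr ⟨j, rfl⟩)
      exact (Finset.inf'_le _ (Finset.mem_univ i)).trans_eq hi
  · refine Finset.le_inf' _ _ fun i _ => ?_
    obtain hi | ⟨j, hj⟩ := (hmem _).1 ⟨i, rfl⟩
    · exact (min_le_left _ _).trans_eq hi.symm
    · rw [← hj]
      refine (min_le_right _ _).trans ?_
      gcongr
      exact Finset.inf'_le _ (Finset.mem_univ j)
end

section
/- The matrix G is positive semidefinite if and only if 0 ≤ s₀ ≤ ((d+1)/d)·λ_min(Σ), where λ_min(Σ) denotes the minimal eigenvalue of Σ. In particular, s₀ = ((d+1)/d)·λ_min(Σ) is the largest value of s₀ for which G is positive semidefinite. -/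
open Matrix

/-- Subtracting a scalar matrix `c • 1` from a Hermitian real matrix leaves a positive semidefinite
matrix exactly when `c` is a lower bound for the eigenvalues. -/
theorem Matrix.IsHermitian.posSemidef_sub_smul_one_iff {n : Type*} [Fintype n] [DecidableEq n]
    {A : Matrix n n ℝ} (hA : A.IsHermitian) (c : ℝ) :
    (A - c • (1 : Matrix n n ℝ)).PosSemidef ↔ ∀ i, c ≤ hA.eigenvalues i := by
  have hdiag : A - c • (1 : Matrix n n ℝ) = Unitary.conjStarAlgAut ℝ _ hA.eigenvectorUnitary
      (diagonal (fun i => hA.eigenvalues i - c)) := by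
    have hsplit : diagonal (fun i => hA.eigenvalues i - c)
        = diagonal (RCLike.ofReal ∘ hA.eigenvalues) - c • (1 : Matrix n n ℝ) := by
      rw [smul_one_eq_diagonal, diagonal_sub]
      rfl
    rw [hsplit, map_sub, map_smul, map_one, ← hA.spectral_theorem]
  rw [hdiag]
  simp [Unitary.isUnit_coe.posSemidef_star_right_conjugate_iff]

theorem knockoffGram_isHermitian (p d : ℕ) {Sig : Matrix (Fin p) (Fin p) ℝ}
    (hSig : Sig.IsHermitian) (s₀ : ℝ) : (knockoffGram p d Sig s₀).IsHermitian := by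
  ext i j
  have h (a b : Fin p) : Sig a b = Sig b a := by simpa using hSig.apply b a
  simp [knockoffGram, one_apply, eq_comm, h i.2 j.2]

/-- The quadratic form of `G` at `x` depends only on the sum of the blocks of `x` and the sum of
squares of the entries of `x`. -/
theorem dotProduct_knockoffGram_mulVec (p d : ℕ) (Sig : Matrix (Fin p) (Fin p) ℝ) (s₀ : ℝ)
    (x : Fin (d + 1) × Fin p → ℝ) :
    x ⬝ᵥ (knockoffGram p d Sig s₀ *ᵥ x)
      = (fun k => ∑ i, x (i, k)) ⬝ᵥ ((Sig - s₀ • (1 : Matrix (Fin p) (Fin p) ℝ)) *ᵥ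
          fun k => ∑ i, x (i, k)) + s₀ * ∑ k, ∑ i, x (i, k) ^ 2 := by
  have hentry (i j : Fin (d + 1) × Fin p) : knockoffGram p d Sig s₀ i j
      = (Sig - s₀ • (1 : Matrix (Fin p) (Fin p) ℝ)) i.2 j.2 + if i = j then s₀ else 0 := by
    by_cases h₁ : i.1 = j.1 <;> by_cases h₂ : i.2 = j.2 <;>
      simp [knockoffGram, Prod.ext_iff, h₁, h₂]
  have hmulVec (i : Fin (d + 1) × Fin p) : (knockoffGram p d Sig s₀ *ᵥ x) i
      = ((Sig - s₀ • (1 : Matrix (Fin p) (Fin p) ℝ)) *ᵥ fun k => ∑ i, x (i, k)) i.2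
        + s₀ * x i := by
    simp only [mulVec, dotProduct, hentry, add_mul, Finset.sum_add_distrib, ite_mul, zero_mul,
      Finset.sum_ite_eq, Finset.mem_univ, if_true, Fintype.sum_prod_type_right, Finset.mul_sum]
  simp only [dotProduct, hmulVec, mul_add, Finset.sum_add_distrib, Fintype.sum_prod_type_right,
    Finset.sum_mul, Finset.mul_sum]
  congr 1
  exact Finset.sum_congr rfl fun k _ => Finset.sum_congr rfl fun i _ => by ring

theorem dotProduct_sub_smul_one_mulVec {n : Type*} [Fintype n] [DecidableEq n]
    (A : Matrix n n ℝ) (c : ℝ) (u : n → ℝ) :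
    u ⬝ᵥ ((A - c • (1 : Matrix n n ℝ)) *ᵥ u) = u ⬝ᵥ (A *ᵥ u) - c * ∑ k, u k ^ 2 := by
  rw [sub_mulVec, dotProduct_sub, smul_mulVec, one_mulVec, dotProduct_smul, smul_eq_mul]
  simp [dotProduct, sq]

theorem knockoffGram_posSemidef_iff_sub_smul_one (p d : ℕ) (hp : 1 ≤ p) (hd : 1 ≤ d)
    {Sig : Matrix (Fin p) (Fin p) ℝ} (hSig : Sig.IsHermitian) (s₀ : ℝ) :
    (knockoffGram p d Sig s₀).PosSemidef ↔
      0 ≤ s₀ ∧ (Sig - (d * s₀ / (d + 1)) • (1 : Matrix (Fin p) (Fin p) ℝ)).PosSemidef := by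
  have hd₁ : (0 : ℝ) < d + 1 := by positivity
  constructor
  · intro hG
    refine ⟨?_, .of_dotProduct_mulVec_nonneg
      (hSig.sub (by simp [IsHermitian])) fun u => ?_⟩
    · have h₀₁ : (0 : Fin (d + 1)) ≠ Fin.last d := by simp [Fin.ext_iff]; omega
      have h := hG.dotProduct_mulVec_nonneg
        (Pi.single (0, ⟨0, hp⟩) 1 - Pi.single (Fin.last d, ⟨0, hp⟩) 1)
      simp [mulVec_sub, sub_dotProduct, knockoffGram, h₀₁, h₀₁.symm] at h
      linarith
    · have h := hG.dotProduct_mulVec_nonneg (fun q => u q.2)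
      rw [star_trivial, dotProduct_knockoffGram_mulVec, dotProduct_sub_smul_one_mulVec] at h
      rw [star_trivial, dotProduct_sub_smul_one_mulVec]
      have hsum : (fun k : Fin p => ∑ _i : Fin (d + 1), u k) = ((d : ℝ) + 1) • u := by
        ext k
        simp
      simp only [hsum] at h
      simp only [mulVec_smul, smul_dotProduct, dotProduct_smul, smul_eq_mul,
        mul_pow, ← Finset.mul_sum, Finset.sum_const, Finset.card_univ, Fintype.card_fin,
        nsmul_eq_mul, Nat.cast_add, Nat.cast_one] at h
      refine nonneg_of_mul_nonneg_right (h.trans_eq ?_) (pow_pos hd₁ 2)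
      field_simp
      ring
  · rintro ⟨hs, hA⟩
    refine .of_dotProduct_mulVec_nonneg (knockoffGram_isHermitian p d hSig s₀) fun x => ?_
    rw [star_trivial, dotProduct_knockoffGram_mulVec, dotProduct_sub_smul_one_mulVec]
    have h := hA.dotProduct_mulVec_nonneg fun k => ∑ i, x (i, k)
    rw [star_trivial, dotProduct_sub_smul_one_mulVec] at h
    have hcs : ∑ k, (∑ i, x (i, k)) ^ 2 ≤ (d + 1) * ∑ k, ∑ i, x (i, k) ^ 2 := by
      rw [Finset.mul_sum]
      refine Finset.sum_le_sum fun k _ => ?_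
      simpa using sq_sum_le_card_mul_sum_sq (s := Finset.univ) (f := fun i => x (i, k))
    have hmul := mul_le_mul_of_nonneg_left hcs (div_nonneg hs hd₁.le)
    have h₁ : s₀ / (d + 1) * ((d + 1) * ∑ k, ∑ i, x (i, k) ^ 2) = s₀ * ∑ k, ∑ i, x (i, k) ^ 2 := by
      field_simp
    have h₂ : s₀ / (d + 1) = s₀ - d * s₀ / (d + 1) := by
      field_simp
      ring
    rw [h₁, h₂, sub_mul] at hmul
    linarith

/-- `G` is positive semidefinite if and only if `0 ≤ s₀ ≤ ((d+1)/d)·λ_min(Σ)`;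
in particular `((d+1)/d)·λ_min(Σ)` is the largest value of `s₀` for which `G` is
positive semidefinite. -/
theorem knockoffGram_posSemidef_iff (p d : ℕ) (hp : 1 ≤ p) (hd : 1 ≤ d)
    (Sig : Matrix (Fin p) (Fin p) ℝ) (hSig : Sig.PosSemidef) (s₀ : ℝ) :
    (knockoffGram p d Sig s₀).PosSemidef
      ↔ (0 ≤ s₀
          ∧ s₀ ≤ (((d : ℝ) + 1) / (d : ℝ))
              * Finset.univ.inf' ⟨(⟨0, hp⟩ : Fin p), Finset.mem_univ _⟩
                  hSig.isHermitian.eigenvalues) := by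
  have hd₀ : (0 : ℝ) < d := by exact_mod_cast hd
  rw [knockoffGram_posSemidef_iff_sub_smul_one p d hp hd hSig.isHermitian,
    hSig.isHermitian.posSemidef_sub_smul_one_iff, div_mul_eq_mul_div, le_div_iff₀ hd₀,
    mul_comm s₀, ← div_le_iff₀' (by positivity), and_congr_right_iff]
  exact fun _ => ((Finset.le_inf'_iff _ _).trans (by simp)).symm
end

section
/- If s₀ = ((d+1)/d)·λ_min(Σ), where λ_min(Σ) denotes the minimal eigenvalue of Σ, then G is singular (i.e., G is positive semidefinite but not positive definite; equivalently, 0 is an eigenvalue of G). -/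
open Matrix

open scoped Kronecker in
/-- When `d * s₀ = (d + 1) * c`, the Gram matrix is `J ⊗ (Σ - c I) + s₀ (I - J / (d + 1)) ⊗ I`,
where `J` is the all-ones matrix. -/
theorem knockoffGram_eq_kronecker_add {p d : ℕ} (Sig : Matrix (Fin p) (Fin p) ℝ) {s₀ c : ℝ}
    (h : d * s₀ = (d + 1) * c) :
    knockoffGram p d Sig s₀ =
      vecMulVec (1 : Fin (d + 1) → ℝ) (star 1) ⊗ₖ (Sig - c • 1) +
      s₀ • ((1 - ((d : ℝ) + 1)⁻¹ • vecMulVec (1 : Fin (d + 1) → ℝ) (star 1)) ⊗ₖ 1) := by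
  have hd : (d : ℝ) + 1 ≠ 0 := by positivity
  obtain rfl : c = d * s₀ / (d + 1) := by field_simp; linarith
  ext ⟨i, a⟩ ⟨j, b⟩
  by_cases hij : i = j <;> by_cases hab : a = b <;>
    simp [knockoffGram, one_apply, hij, hab]
  all_goals (field_simp; ring)

/-- The centering matrix is positive semidefinite. -/
theorem posSemidef_one_sub_inv_smul_ones (d : ℕ) :
    ((1 : Matrix (Fin (d + 1)) (Fin (d + 1)) ℝ) -
      ((d : ℝ) + 1)⁻¹ • vecMulVec (1 : Fin (d + 1) → ℝ) (star 1)).PosSemidef := by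
  set J : Matrix (Fin (d + 1)) (Fin (d + 1)) ℝ :=
    vecMulVec (1 : Fin (d + 1) → ℝ) (star 1)
  have hd : (d : ℝ) + 1 ≠ 0 := by positivity
  have hJ : J * J = ((d : ℝ) + 1) • J := by
    ext i j
    simp [J, mul_apply]
  have hH : (1 - ((d : ℝ) + 1)⁻¹ • J)ᴴ = 1 - ((d : ℝ) + 1)⁻¹ • J := by
    ext i j
    simp [J, conjTranspose_apply, one_apply, eq_comm]
  have hidem : (1 - ((d : ℝ) + 1)⁻¹ • J)ᴴ * (1 - ((d : ℝ) + 1)⁻¹ • J)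
      = 1 - ((d : ℝ) + 1)⁻¹ • J := by
    rw [hH]
    simp only [sub_mul, mul_sub, one_mul, mul_one, smul_mul_assoc, mul_smul_comm, hJ, smul_smul]
    simp [inv_mul_cancel₀ hd]
  exact hidem ▸ posSemidef_conjTranspose_mul_self _

/-- A Hermitian matrix minus a lower bound for its eigenvalues is positive semidefinite. -/
theorem Matrix.IsHermitian.posSemidef_sub_smul_one {n : Type*} [Fintype n] [DecidableEq n]
    {A : Matrix n n ℝ} (hA : A.IsHermitian) {c : ℝ} (hc : ∀ i, c ≤ hA.eigenvalues i) :
    (A - c • 1).PosSemidef := by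
  have hD : (diagonal (fun i => hA.eigenvalues i - c)).PosSemidef :=
    PosSemidef.diagonal fun i => sub_nonneg.mpr (hc i)
  have hE : A - c • 1 = Unitary.conjStarAlgAut ℝ _ hA.eigenvectorUnitary
      (diagonal (fun i => hA.eigenvalues i - c)) := by
    have : diagonal (fun i => hA.eigenvalues i - c)
        = diagonal (RCLike.ofReal ∘ hA.eigenvalues) - c • (1 : Matrix n n ℝ) := by
      ext i j
      by_cases h : i = j <;> simp [h]
    rw [this, map_sub, map_smul, map_one, ← hA.spectral_theorem]
  rw [hE, Unitary.conjStarAlgAut_apply]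
  exact hD.mul_mul_conjTranspose_same _

/-- Repeating an eigenvector of `Σ` for `c` in every block gives a null vector. -/
theorem knockoffGram_mulVec_eq_zero {p d : ℕ} {Sig : Matrix (Fin p) (Fin p) ℝ} {s₀ c : ℝ}
    (h : d * s₀ = (d + 1) * c) {v : Fin p → ℝ} (hv : Sig *ᵥ v = c • v) :
    knockoffGram p d Sig s₀ *ᵥ (fun i => v i.2) = 0 := by
  ext ⟨i, a⟩
  have hva : ∑ b, Sig a b * v b = c * v a := congrFun hv a
  have hrow (j : Fin (d + 1)) : ∑ b, knockoffGram p d Sig s₀ (i, a) (j, b) * v b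
      = (c - s₀) * v a + if i = j then s₀ * v a else 0 := by
    by_cases hij : i = j
    · simp [knockoffGram, hij, hva, sub_mul]
    · simp [knockoffGram, hij, hva, sub_mul, Finset.sum_sub_distrib, one_apply]
  simp only [mulVec, dotProduct, Fintype.sum_prod_type, hrow, Finset.sum_add_distrib]
  simp
  linear_combination (-v a) * h

/-- If `s₀ = ((d+1)/d)·λ_min(Σ)` then `G` is singular: it is positive semidefinite
but not positive definite (equivalently, `0` is an eigenvalue of `G`). -/
theorem knockoffGram_singular_at_critical (p d : ℕ) (hp : 1 ≤ p) (hd : 1 ≤ d)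
    (Sig : Matrix (Fin p) (Fin p) ℝ) (hSig : Sig.PosSemidef) (s₀ : ℝ)
    (hs₀ : s₀ = (((d : ℝ) + 1) / (d : ℝ))
        * Finset.univ.inf' ⟨(⟨0, hp⟩ : Fin p), Finset.mem_univ _⟩
            hSig.isHermitian.eigenvalues) :
    (knockoffGram p d Sig s₀).PosSemidef ∧ ¬ (knockoffGram p d Sig s₀).PosDef := by
  set c := Finset.univ.inf' ⟨(⟨0, hp⟩ : Fin p), Finset.mem_univ _⟩
    hSig.isHermitian.eigenvalues with hc
  have hle (i : Fin p) : c ≤ hSig.isHermitian.eigenvalues i :=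
    Finset.inf'_le _ (Finset.mem_univ i)
  obtain ⟨k, -, hk⟩ := Finset.exists_mem_eq_inf' ⟨(⟨0, hp⟩ : Fin p), Finset.mem_univ _⟩
    hSig.isHermitian.eigenvalues
  rw [← hc] at hk
  have hc₀ : 0 ≤ c := hk ▸ hSig.eigenvalues_nonneg k
  have hd₀ : (0 : ℝ) < d := by exact_mod_cast hd
  have h : d * s₀ = (d + 1) * c := by rw [hs₀]; field_simp
  have hs : 0 ≤ s₀ := by rw [hs₀]; positivity
  refine ⟨?_, fun hpos => ?_⟩
  · rw [knockoffGram_eq_kronecker_add Sig h]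
    exact ((posSemidef_vecMulVec_self_star _).kronecker
      (hSig.isHermitian.posSemidef_sub_smul_one hle)).add
      (((posSemidef_one_sub_inv_smul_ones d).kronecker PosSemidef.one).smul hs)
  · set v : Fin p → ℝ := ⇑(hSig.isHermitian.eigenvectorBasis k)
    have hv : Sig *ᵥ v = c • v := by
      rw [hk]; exact hSig.isHermitian.mulVec_eigenvectorBasis k
    have hv₀ : (fun i : Fin (d + 1) × Fin p => v i.2) ≠ 0 := fun h₀ =>
      hSig.isHermitian.eigenvectorBasis.orthonormal.ne_zero k <| by
        ext a
        exact congrFun h₀ (0, a)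
    have := hpos.dotProduct_mulVec_pos hv₀
    simp [knockoffGram_mulVec_eq_zero h hv] at this
end

section
/- Suppose n ≥ (d+1)p, X is an n×p real matrix with Xᵀ X = Σ, and G is positive semidefinite. Then there exists an n×(dp) real matrix X̃ such that the Gram matrix of the augmented n×(d+1)p matrix [X X̃] equals G, i.e., [X X̃]ᵀ[X X̃] = G. Equivalently, X̃ᵀX̃ has diagonal p×p blocks Σ and off-diagonal blocks Σ₀, and XᵀX̃ consists of d horizontal copies of Σ₀. -/
open Matrix

/-- The augmented `n × (d+1)p` matrix `[X X̃]`: its column `(0, i₀)` is the `i₀`-th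
column of `X` and its column `(i₁+1, i₀)` is the column `(i₁, i₀)` of `X̃`. -/
def augment {n p d : ℕ} (X : Matrix (Fin n) (Fin p) ℝ)
    (Xt : Matrix (Fin n) (Fin d × Fin p) ℝ) :
    Matrix (Fin n) (Fin (d + 1) × Fin p) ℝ :=
  fun r i => Fin.cases (X r i.2) (fun k => Xt r (k, i.2)) i.1

/-- Two finite families with the same Gram matrix in a finite-dimensional real inner product
space are related by a linear isometry of the whole space. -/
theorem exists_linearIsometry_of_inner_eq {ι E : Type*} [Fintype ι] [NormedAddCommGroup E]
    [InnerProductSpace ℝ E] [FiniteDimensional ℝ E] (v w : ι → E)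
    (h : ∀ i j, inner ℝ (v i) (v j) = inner ℝ (w i) (w j)) :
    ∃ L : E →ₗᵢ[ℝ] E, ∀ i, L (v i) = w i := by
  classical
  set A := Fintype.linearCombination ℝ v with hA
  set B := Fintype.linearCombination ℝ w with hB
  have hAB : ∀ c, ‖A c‖ = ‖B c‖ := fun c => by
    rw [← sq_eq_sq₀ (norm_nonneg _) (norm_nonneg _), ← real_inner_self_eq_norm_sq,
      ← real_inner_self_eq_norm_sq]
    simp only [hA, hB, Fintype.linearCombination_apply, sum_inner, inner_sum, inner_smul_left,
      inner_smul_right, h]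
  obtain ⟨s, hs⟩ := A.rangeRestrict.exists_rightInverse_of_surjective A.range_rangeRestrict
  have hs' : ∀ y, A (s y) = y := fun y => congrArg Subtype.val (LinearMap.congr_fun hs y)
  let f : A.range →ₗᵢ[ℝ] E :=
    { toLinearMap := B ∘ₗ s
      norm_map' := fun y => by
        rw [LinearMap.comp_apply, ← hAB, hs', Submodule.coe_norm] }
  refine ⟨f.extend, fun i => ?_⟩
  have hAi : A (Pi.single i 1) = v i := by simp [hA]
  have hBi : B (Pi.single i 1) = w i := by simp [hB]
  have hf : f ⟨v i, Pi.single i 1, hAi⟩ = w i := by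
    change B (s _) = w i
    rw [← hBi, ← sub_eq_zero, ← map_sub, ← norm_eq_zero, ← hAB, map_sub, hs', hAi, sub_self,
      norm_zero]
  rw [← hf]
  exact f.extend_apply ⟨v i, Pi.single i 1, hAi⟩

open scoped MatrixOrder Matrix.Norms.L2Operator in
/-- A real positive semidefinite matrix is the Gram matrix of vectors in any Euclidean space
whose dimension is at least the size of the matrix. -/
theorem exists_inner_eq_of_posSemidef {ι κ : Type*} [Fintype ι] [Fintype κ]
    (hcard : Fintype.card ι ≤ Fintype.card κ) {G : Matrix ι ι ℝ} (hG : G.PosSemidef) :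
    ∃ b : ι → EuclideanSpace ℝ κ, ∀ i j, inner ℝ (b i) (b j) = G i j := by
  classical
  obtain ⟨B, rfl⟩ := CStarAlgebra.nonneg_iff_eq_star_mul_self.mp hG.nonneg
  obtain ⟨e⟩ := Function.Embedding.nonempty_of_card_le hcard
  refine ⟨fun i => ∑ k, B k i • EuclideanSpace.single (e k) (1 : ℝ), fun i j => ?_⟩
  simp [sum_inner, inner_sum, Matrix.star_eq_conjTranspose, inner_smul_left, inner_smul_right,
    Matrix.mul_apply, EuclideanSpace.inner_single_left, PiLp.single_apply, e.injective.eq_iff,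
    mul_comm]

/-- If `n ≥ (d+1)p`, `XᵀX = Σ` and `G` is positive semidefinite, then there exists an
`n × dp` matrix `X̃` such that the Gram matrix of the augmented matrix `[X X̃]` is
`G`, i.e. `[X X̃]ᵀ[X X̃] = G`. -/
theorem exists_knockoffs (n p d : ℕ) (hp : 1 ≤ p) (hd : 1 ≤ d)
    (hn : (d + 1) * p ≤ n)
    (Sig : Matrix (Fin p) (Fin p) ℝ) (hSig : Sig.PosSemidef) (s₀ : ℝ)
    (X : Matrix (Fin n) (Fin p) ℝ) (hX : Xᵀ * X = Sig)
    (hG : (knockoffGram p d Sig s₀).PosSemidef) :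
    ∃ Xt : Matrix (Fin n) (Fin d × Fin p) ℝ,
      (augment X Xt)ᵀ * augment X Xt = knockoffGram p d Sig s₀ := by
  obtain ⟨b, hb⟩ := exists_inner_eq_of_posSemidef (κ := Fin n) (by simpa using hn) hG
  obtain ⟨L, hL⟩ := exists_linearIsometry_of_inner_eq (fun i => b (0, i))
    (fun i => WithLp.toLp 2 (fun r => X r i)) (fun i j => by
      rw [hb, ← hX]
      simp [knockoffGram, Matrix.mul_apply, PiLp.inner_apply, mul_comm])
  have haug : augment X (fun r k => L (b (k.1.succ, k.2)) r) =
      Matrix.of fun r i => L (b i) r := by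
    ext r ⟨i, k⟩
    cases i using Fin.cases with
    | zero => simp [augment, hL]
    | succ i => simp [augment]
  refine ⟨fun r k => L (b (k.1.succ, k.2)) r, ?_⟩
  rw [haug]
  ext i j
  rw [← hb, ← L.inner_map_map, Matrix.mul_apply, PiLp.inner_apply]
  simp [mul_comm]
end

section
/- (Claim 1) Let X̂ be any n×(d+1)p real matrix with X̂ᵀX̂ = G. Then for every sequence Π = (π₁,…,π_p) of permutations of {1,…,d+1} (not necessarily null-only), the column-permuted matrix satisfies (X̂∘Π)ᵀ(X̂∘Π) = X̂ᵀX̂ = G. -/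
open Matrix

/-- Given a sequence `Π = (π₁, …, π_p)` of permutations of `{1, …, d+1}`, the matrix
`X̂∘Π` whose column `(i₁, i₀)` is the column `(π_{i₀}(i₁), i₀)` of `X̂`. -/
def permCols {n p d : ℕ} (Xhat : Matrix (Fin n) (Fin (d + 1) × Fin p) ℝ)
    (perms : Fin p → Equiv.Perm (Fin (d + 1))) :
    Matrix (Fin n) (Fin (d + 1) × Fin p) ℝ :=
  fun r i => Xhat r (perms i.2 i.1, i.2)

/-- The Gram matrix of `X̂∘Π` is the Gram matrix of `X̂` with rows and columns reindexed. -/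
theorem permCols_transpose_mul_permCols {n p d : ℕ}
    (Xhat : Matrix (Fin n) (Fin (d + 1) × Fin p) ℝ)
    (perms : Fin p → Equiv.Perm (Fin (d + 1))) :
    (permCols Xhat perms)ᵀ * permCols Xhat perms =
      (Xhatᵀ * Xhat).submatrix (fun i => (perms i.2 i.1, i.2)) (fun i => (perms i.2 i.1, i.2)) :=
  rfl

/-- `G` is invariant under permuting the copies of each variable. -/
theorem knockoffGram_submatrix_perms (p d : ℕ) (Sig : Matrix (Fin p) (Fin p) ℝ) (s₀ : ℝ)
    (perms : Fin p → Equiv.Perm (Fin (d + 1))) :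
    (knockoffGram p d Sig s₀).submatrix
        (fun i => (perms i.2 i.1, i.2)) (fun i => (perms i.2 i.1, i.2)) =
      knockoffGram p d Sig s₀ := by
  ext ⟨k, a⟩ ⟨l, b⟩
  by_cases hab : a = b
  · subst hab
    simp [knockoffGram]
  · simp [knockoffGram, hab]

/-- (Claim 1) If `X̂ᵀX̂ = G`, then for every sequence `Π` of permutations of the
`d+1` copies (not necessarily null-only), `(X̂∘Π)ᵀ(X̂∘Π) = X̂ᵀX̂ = G`. -/
theorem permCols_gram (n p d : ℕ) (hp : 1 ≤ p) (hd : 1 ≤ d)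
    (Sig : Matrix (Fin p) (Fin p) ℝ) (hSig : Sig.PosSemidef) (s₀ : ℝ)
    (Xhat : Matrix (Fin n) (Fin (d + 1) × Fin p) ℝ)
    (hGram : Xhatᵀ * Xhat = knockoffGram p d Sig s₀)
    (perms : Fin p → Equiv.Perm (Fin (d + 1))) :
    (permCols Xhat perms)ᵀ * permCols Xhat perms = Xhatᵀ * Xhat
      ∧ (permCols Xhat perms)ᵀ * permCols Xhat perms = knockoffGram p d Sig s₀ := by
  have h : (permCols Xhat perms)ᵀ * permCols Xhat perms = knockoffGram p d Sig s₀ := by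
    rw [permCols_transpose_mul_permCols, hGram, knockoffGram_submatrix_perms]
  exact ⟨h.trans hGram.symm, h⟩
end

section
/- Let X̂ be an n×(d+1)p real matrix with X̂ᵀX̂ = G whose first p columns form the matrix X, and let β ∈ ℝ^p. Then for every null-only sequence of permutations Π = (π₁,…,π_p) with respect to β, the mean vectors agree: (X̂∘Π)ᵀ X β = X̂ᵀ X β. -/
open Matrix

/-- Entries of `X̂ᵀXβ` in terms of the Gram matrix `X̂ᵀX̂`, where `X` is the first block of
columns of `X̂`. -/
theorem transpose_mulVec_firstBlock {n p d : ℕ}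
    {Xhat : Matrix (Fin n) (Fin (d + 1) × Fin p) ℝ} {X : Matrix (Fin n) (Fin p) ℝ}
    (hfirst : ∀ (r : Fin n) (i₀ : Fin p), Xhat r (0, i₀) = X r i₀)
    (β : Fin p → ℝ) (i : Fin (d + 1) × Fin p) :
    Xhatᵀ.mulVec (X.mulVec β) i = ∑ j, (Xhatᵀ * Xhat) i (0, j) * β j := by
  rw [Matrix.mulVec_mulVec]
  simp [Matrix.mulVec, dotProduct, Matrix.mul_apply, hfirst]

/-- Off the diagonal of each block, the entries of `knockoffGram` do not depend on the block. -/
theorem knockoffGram_apply_of_ne {p d : ℕ} (Sig : Matrix (Fin p) (Fin p) ℝ) (s₀ : ℝ)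
    (a b : Fin (d + 1)) {i j : Fin p} (hij : i ≠ j) :
    knockoffGram p d Sig s₀ (a, i) (b, j) = Sig i j := by
  simp [knockoffGram, Matrix.one_apply_ne hij]

/-- If `X̂ᵀX̂ = G`, the first `p` columns of `X̂` form `X`, and `Π` is a null-only
sequence of permutations with respect to `β` (i.e. `π_{i₀} = Id` whenever
`β_{i₀} ≠ 0`), then the mean vectors agree: `(X̂∘Π)ᵀXβ = X̂ᵀXβ`. -/
theorem permCols_mean (n p d : ℕ) (hp : 1 ≤ p) (hd : 1 ≤ d)
    (Sig : Matrix (Fin p) (Fin p) ℝ) (hSig : Sig.PosSemidef) (s₀ : ℝ)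
    (Xhat : Matrix (Fin n) (Fin (d + 1) × Fin p) ℝ)
    (X : Matrix (Fin n) (Fin p) ℝ)
    (hGram : Xhatᵀ * Xhat = knockoffGram p d Sig s₀)
    (hfirst : ∀ (r : Fin n) (i₀ : Fin p), Xhat r (0, i₀) = X r i₀)
    (β : Fin p → ℝ)
    (perms : Fin p → Equiv.Perm (Fin (d + 1)))
    (hnull : ∀ i₀ : Fin p, β i₀ ≠ 0 → perms i₀ = 1) :
    (permCols Xhat perms)ᵀ.mulVec (X.mulVec β) = Xhatᵀ.mulVec (X.mulVec β) := by
  ext ⟨a, i⟩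
  change Xhatᵀ.mulVec (X.mulVec β) (perms i a, i) = _
  simp only [transpose_mulVec_firstBlock hfirst, hGram]
  refine Finset.sum_congr rfl fun j _ => ?_
  by_cases hβ : β j = 0
  · simp [hβ]
  by_cases hij : i = j
  · subst hij
    simp [hnull i hβ]
  · simp only [knockoffGram_apply_of_ne Sig s₀ _ _ hij]
end
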